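/- Let d ≥ 1 and β ∈ (1, 2]. There exist a constant C > 0 depending only on d and β and b_0 > 0 such that for all b ∈ (0, b_0) and all s ∈ S_d, the Dirichlet(s/b + 1, (1−‖s‖₁)/b + 1) distribution satisfies ∫_{S_d} ‖t − s‖₁^β · K_{s/b + 1, (1−‖s‖₁)/b + 1}(t) dt ≤ C · b^{β/2}. -/

import Mathlib

open MeasureTheory Filter Topology
open scoped ENNReal BigOperators

noncomputable section

/-- The d-dimensional simplex `S_d = {s ∈ [0,1]^d : s_1 + ⋯ + s_d ≤ 1}`. -/
def Sd (d : ℕ) : Set (Fin d → ℝ) :=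
  {s | (∀ i, 0 ≤ s i ∧ s i ≤ 1) ∧ ∑ i, s i ≤ 1}

/-- The Dirichlet density `K_{u,v}` on `S_d` (0 outside). -/
def dirK (d : ℕ) (u : Fin d → ℝ) (v : ℝ) : (Fin d → ℝ) → ℝ :=
  Set.indicator (Sd d)
    (fun s => Real.Gamma (v + ∑ i, u i) / (Real.Gamma v * ∏ i, Real.Gamma (u i)) *
      (1 - ∑ i, s i) ^ (v - 1) * ∏ i, (s i) ^ (u i - 1))

/-- The Dirichlet kernel `K_{s/b+1, (1-‖s‖₁)/b+1}` at location `s` with bandwidth `b`. -/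
def dirKb (d : ℕ) (b : ℝ) (s : Fin d → ℝ) : (Fin d → ℝ) → ℝ :=
  dirK d (fun i => s i / b + 1) ((1 - ∑ i, s i) / b + 1)

/-- The Dirichlet kernel density estimator based on the sample `X`. -/
def fhat (d n : ℕ) (b : ℝ) (X : Fin n → Fin d → ℝ) (s : Fin d → ℝ) : ℝ :=
  (n : ℝ)⁻¹ * ∑ i, dirKb d b s (X i)

/-- `m` = the largest integer strictly less than `β` (for `β > 0`). -/
def mOf (β : ℝ) : ℕ := ⌈β⌉₊ - 1

/-- Partial derivative of order `j` in the directions `v` (on the interior of the simplex). -/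
def Dpartial (d j : ℕ) (f : (Fin d → ℝ) → ℝ) (v : Fin j → Fin d) (s : Fin d → ℝ) : ℝ :=
  iteratedFDerivWithin ℝ j f (interior (Sd d)) s fun i => Pi.single (v i) 1

/-- The Hölder class `Σ(d, β, L)` of probability densities supported on `S_d`. -/
def holderClass (d : ℕ) (β L : ℝ) : Set ((Fin d → ℝ) → ℝ) :=
  {f | (∀ s, 0 ≤ f s) ∧ (∀ s, s ∉ Sd d → f s = 0) ∧ (∫ s in Sd d, f s) = 1 ∧
    ContDiffOn ℝ (mOf β) f (interior (Sd d)) ∧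
    ∀ v : Fin (mOf β) → Fin d, ∀ s ∈ interior (Sd d), ∀ t ∈ interior (Sd d),
      |Dpartial d (mOf β) f v s - Dpartial d (mOf β) f v t| ≤
        L * (∑ i, |s i - t i|) ^ (β - (mOf β : ℝ))}

/-- `E_f ‖f̂_{n,b} − f‖_p^p`: expectation, under i.i.d. sampling of `X_1, …, X_n` from the
density `f`, of the `p`-th power of the `L^p` distance between `f̂_{n,b}` and `f` on `S_d`. -/
def lpRiskPow (d n : ℕ) (b p : ℝ) (f : (Fin d → ℝ) → ℝ) : ℝ :=
  ∫ ω : Fin n → Fin d → ℝ,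
    (∏ i, f (ω i)) * ∫ s in Sd d, |fhat d n b ω s - f s| ^ p

lemma real_beta_scaled {a c r : ℝ} (ha : 1 ≤ a) (hc : 1 ≤ c) (hr : 0 < r) :
    ∫ x in (0 : ℝ)..r, x ^ (a - 1) * (r - x) ^ (c - 1) =
      r ^ (a + c - 1) * (Real.Gamma a * Real.Gamma c / Real.Gamma (a + c)) := by
  have h := Complex.betaIntegral_scaled (a : ℂ) (c : ℂ) hr
  rw [Complex.betaIntegral_eq_Gamma_mul_div _ _ (by simp; linarith) (by simp; linarith)] at h
  have h2 : ∫ x in (0 : ℝ)..r, (x : ℂ) ^ ((a : ℂ) - 1) * ((r : ℂ) - x) ^ ((c : ℂ) - 1) =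
      ∫ x in (0 : ℝ)..r, ((x ^ (a - 1) * (r - x) ^ (c - 1) : ℝ) : ℂ) := by
    apply intervalIntegral.integral_congr
    intro x hx
    rw [Set.uIcc_of_le hr.le] at hx
    simp only
    rw [Complex.ofReal_mul, Complex.ofReal_cpow hx.1, Complex.ofReal_cpow (by linarith [hx.2])]
    push_cast
    rfl
  rw [h2, intervalIntegral.integral_ofReal, ← Complex.ofReal_add, Complex.Gamma_ofReal,
    Complex.Gamma_ofReal, Complex.Gamma_ofReal] at h
  have h3 : (r : ℂ) ^ (((a + c : ℝ) : ℂ) - 1) = ((r ^ (a + c - 1) : ℝ) : ℂ) := by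
    rw [Complex.ofReal_cpow hr.le]; push_cast; rfl
  rw [h3] at h
  exact_mod_cast h

/-- The truncated power `x₊^{a-1}` with values in `[0,∞]`. -/
def hpow (a x : ℝ) : ℝ≥0∞ := if 0 ≤ x then ENNReal.ofReal (x ^ (a - 1)) else 0

lemma measurable_hpow (a : ℝ) : Measurable (hpow a) :=
  Measurable.ite measurableSet_Ici (by fun_prop) measurable_const

lemma lintegral_hpow {a c : ℝ} (ha : 1 ≤ a) (hc : 1 ≤ c) (r : ℝ) :
    ∫⁻ x, hpow a x * hpow c (r - x) =
      ENNReal.ofReal (Real.Gamma a * Real.Gamma c / Real.Gamma (a + c)) * hpow (a + c) r := by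
  have hG : 0 ≤ Real.Gamma a * Real.Gamma c / Real.Gamma (a + c) := by
    have h1 := Real.Gamma_pos_of_pos (show 0 < a by linarith)
    have h2 := Real.Gamma_pos_of_pos (show 0 < c by linarith)
    have h3 := Real.Gamma_pos_of_pos (show 0 < a + c by linarith)
    positivity
  have hI : ∫⁻ x, hpow a x * hpow c (r - x) =
      ∫⁻ x in Set.Icc 0 r, ENNReal.ofReal (x ^ (a - 1) * (r - x) ^ (c - 1)) := by
    rw [← lintegral_indicator measurableSet_Icc]
    congr 1
    ext x
    by_cases hx : x ∈ Set.Icc 0 r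
    · rw [Set.indicator_of_mem hx, hpow, hpow, if_pos hx.1, if_pos (by linarith [hx.2]),
        ENNReal.ofReal_mul (Real.rpow_nonneg hx.1 _)]
    · rw [Set.indicator_of_notMem hx]
      by_cases h0 : 0 ≤ x
      · have : ¬ (0 ≤ r - x) := fun h => hx ⟨h0, by linarith⟩
        simp [hpow, this]
      · simp [hpow, h0]
  rw [hI]
  rcases lt_trichotomy r 0 with hr | hr | hr
  · simp [hpow, not_le.2 hr]
  · subst hr
    have : (0 : ℝ) ^ (a + c - 1) = 0 := Real.zero_rpow (by linarith)
    simp [hpow, this]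
  · have hcont : Continuous fun x : ℝ => x ^ (a - 1) * (r - x) ^ (c - 1) :=
      (Real.continuous_rpow_const (by linarith)).mul
        ((Real.continuous_rpow_const (by linarith)).comp (continuous_const.sub continuous_id))
    rw [← ofReal_integral_eq_lintegral_ofReal hcont.integrableOn_Icc, integral_Icc_eq_integral_Ioc,
      ← intervalIntegral.integral_of_le hr.le, real_beta_scaled ha hc hr, hpow, if_pos hr.le,
      mul_comm, ENNReal.ofReal_mul hG]
    filter_upwards [ae_restrict_mem measurableSet_Icc] with x hx
    exact mul_nonneg (Real.rpow_nonneg hx.1 _) (Real.rpow_nonneg (by linarith [hx.2]) _)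

lemma lintegral_dir (d : ℕ) : ∀ (u : Fin d → ℝ) (v r : ℝ), (∀ i, 1 ≤ u i) → 1 ≤ v →
    ∫⁻ t : Fin d → ℝ, hpow v (r - ∑ i, t i) * ∏ i, hpow (u i) (t i) =
      ENNReal.ofReal (Real.Gamma v * (∏ i, Real.Gamma (u i)) / Real.Gamma (v + ∑ i, u i)) *
        hpow (v + ∑ i, u i) r := by
  induction d with
  | zero =>
    intro u v r hu hv
    have : Real.Gamma v ≠ 0 := (Real.Gamma_pos_of_pos (by linarith)).ne'
    simp [lintegral_unique, this, volume_pi]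
  | succ d ih =>
    intro u v r hu hv
    have hV : 1 ≤ v + ∑ i, u (Fin.succ i) := by
      have : 0 ≤ ∑ i, u (Fin.succ i) := Finset.sum_nonneg fun i _ => by linarith [hu i.succ]
      linarith
    rw [(volume_preserving_piFinSuccAbove (fun _ : Fin (d + 1) => ℝ) 0).symm.lintegral_map_equiv,
      Measure.volume_eq_prod, lintegral_prod]
    · simp only [MeasurableEquiv.piFinSuccAbove_symm_apply, Fin.insertNthEquiv_zero, Fin.consEquiv_apply,
        Fin.sum_univ_succ, Fin.prod_univ_succ, Fin.cons_zero, Fin.cons_succ]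
      have step : ∀ x : ℝ, ∫⁻ y : Fin d → ℝ, hpow v (r - (x + ∑ i, y i)) *
          (hpow (u 0) x * ∏ i, hpow (u (Fin.succ i)) (y i)) =
          ENNReal.ofReal (Real.Gamma v * (∏ i, Real.Gamma (u (Fin.succ i))) /
            Real.Gamma (v + ∑ i, u (Fin.succ i))) *
            (hpow (u 0) x * hpow (v + ∑ i, u (Fin.succ i)) (r - x)) := by
        intro x
        have h := ih (fun i => u (Fin.succ i)) v (r - x) (fun i => hu _) hv
        rw [mul_left_comm, ← h, ← lintegral_const_mul]
        · congr 1
          ext y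
          rw [← sub_sub]
          ring
        · refine Measurable.mul ((measurable_hpow v).comp (by fun_prop))
            (Finset.measurable_prod _ fun i _ => (measurable_hpow _).comp (by fun_prop))
      simp_rw [step]
      rw [lintegral_const_mul, lintegral_hpow (hu 0) hV, ← mul_assoc, ← ENNReal.ofReal_mul]
      · have e : u 0 + (v + ∑ i, u (Fin.succ i)) = v + (u 0 + ∑ i, u (Fin.succ i)) := by ring
        rw [e]
        congr 2
        have := (Real.Gamma_pos_of_pos (show 0 < v + ∑ i, u (Fin.succ i) by linarith)).ne'
        field_simp
      · have h1 := Real.Gamma_pos_of_pos (show 0 < v by linarith)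
        have h2 := Real.Gamma_pos_of_pos (show 0 < v + ∑ i, u (Fin.succ i) by linarith)
        have h3 : 0 ≤ ∏ i, Real.Gamma (u (Fin.succ i)) :=
          Finset.prod_nonneg fun i _ => (Real.Gamma_pos_of_pos (by linarith [hu i.succ])).le
        positivity
      · exact (measurable_hpow _).mul ((measurable_hpow _).comp (by fun_prop))
    · apply Measurable.aemeasurable
      apply Measurable.comp (g := fun t : Fin (d + 1) → ℝ =>
        hpow v (r - ∑ i, t i) * ∏ i, hpow (u i) (t i)) _ (MeasurableEquiv.measurable _)
      refine Measurable.mul ((measurable_hpow v).comp (by fun_prop))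
            (Finset.measurable_prod _ fun i _ => (measurable_hpow _).comp (by fun_prop))

lemma measurableSet_Sd (d : ℕ) : MeasurableSet (Sd d) := by
  unfold Sd
  apply MeasurableSet.inter
  · show MeasurableSet {s : Fin d → ℝ | ∀ i, 0 ≤ s i ∧ s i ≤ 1}
    simp only [Set.ofPred_forall]
    exact MeasurableSet.iInter fun i => measurableSet_Icc.preimage (measurable_pi_apply i)
  · exact measurableSet_le (f := fun s : Fin d → ℝ => ∑ i, s i) (g := fun _ => (1 : ℝ))
      (by fun_prop) (by fun_prop)

lemma dirK_const_pos {d : ℕ} {u : Fin d → ℝ} {v : ℝ} (hu : ∀ i, 1 ≤ u i) (hv : 1 ≤ v) :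
    0 < Real.Gamma (v + ∑ i, u i) / (Real.Gamma v * ∏ i, Real.Gamma (u i)) := by
  have hs : 0 ≤ ∑ i, u i := Finset.sum_nonneg fun i _ => by linarith [hu i]
  have h1 := Real.Gamma_pos_of_pos (show 0 < v by linarith)
  have h2 := Real.Gamma_pos_of_pos (show 0 < v + ∑ i, u i by linarith)
  have h3 : 0 < ∏ i, Real.Gamma (u i) :=
    Finset.prod_pos fun i _ => Real.Gamma_pos_of_pos (by linarith [hu i])
  positivity

lemma dirK_nonneg {d : ℕ} {u : Fin d → ℝ} {v : ℝ} (hu : ∀ i, 1 ≤ u i) (hv : 1 ≤ v)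
    (t : Fin d → ℝ) : 0 ≤ dirK d u v t := by
  apply Set.indicator_nonneg
  intro t ht
  refine mul_nonneg (mul_nonneg (dirK_const_pos hu hv).le
    (Real.rpow_nonneg (by linarith [ht.2]) _)) (Finset.prod_nonneg fun i _ =>
    Real.rpow_nonneg (ht.1 i).1 _)

lemma measurable_dirK {d : ℕ} (u : Fin d → ℝ) (v : ℝ) : Measurable (dirK d u v) := by
  unfold dirK
  exact Measurable.indicator (by fun_prop) (measurableSet_Sd d)

lemma lintegral_dirK {d : ℕ} {u : Fin d → ℝ} {v : ℝ} (hu : ∀ i, 1 ≤ u i) (hv : 1 ≤ v) :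
    ∫⁻ t, ENNReal.ofReal (dirK d u v t) = 1 := by
  have hC := dirK_const_pos hu hv
  have key : ∀ t, ENNReal.ofReal (dirK d u v t) =
      ENNReal.ofReal (Real.Gamma (v + ∑ i, u i) / (Real.Gamma v * ∏ i, Real.Gamma (u i))) *
      (hpow v (1 - ∑ i, t i) * ∏ i, hpow (u i) (t i)) := by
    intro t
    by_cases ht : t ∈ Sd d
    · have hp : ∏ i, hpow (u i) (t i) = ENNReal.ofReal (∏ i, (t i) ^ (u i - 1)) := by
        rw [ENNReal.ofReal_prod_of_nonneg fun i _ => Real.rpow_nonneg (ht.1 i).1 _]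
        exact Finset.prod_congr rfl fun i _ => by rw [hpow, if_pos (ht.1 i).1]
      have h0 : 0 ≤ 1 - ∑ i, t i := by linarith [ht.2]
      rw [dirK, Set.indicator_of_mem ht, hp, hpow, if_pos h0, mul_assoc,
        ENNReal.ofReal_mul hC.le, ENNReal.ofReal_mul (Real.rpow_nonneg h0 _)]
    · rw [dirK, Set.indicator_of_notMem ht, ENNReal.ofReal_zero]
      by_cases h0 : ∀ i, 0 ≤ t i
      · have : ¬ (0 ≤ 1 - ∑ i, t i) := by
          intro h
          refine ht ⟨fun i => ⟨h0 i, ?_⟩, by linarith⟩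
          have := Finset.single_le_sum (f := t) (fun i _ => h0 i) (Finset.mem_univ i)
          linarith
        simp [hpow, this]
      · push Not at h0
        obtain ⟨i, hi⟩ := h0
        have : ∏ i, hpow (u i) (t i) = 0 :=
          Finset.prod_eq_zero (Finset.mem_univ i) (by simp [hpow, hi])
        simp [this]
  simp_rw [key]
  rw [lintegral_const_mul, lintegral_dir d u v 1 hu hv, ← mul_assoc, ← ENNReal.ofReal_mul hC.le]
  · have : Real.Gamma (v + ∑ i, u i) / (Real.Gamma v * ∏ i, Real.Gamma (u i)) *
      (Real.Gamma v * (∏ i, Real.Gamma (u i)) / Real.Gamma (v + ∑ i, u i)) = 1 := by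
      rw [← inv_div (Real.Gamma (v + ∑ i, u i))]
      exact mul_inv_cancel₀ hC.ne'
    rw [this]
    simp [hpow]
  · refine Measurable.mul ((measurable_hpow v).comp (by fun_prop))
            (Finset.measurable_prod _ fun i _ => (measurable_hpow _).comp (by fun_prop))

lemma integrable_dirK {d : ℕ} {u : Fin d → ℝ} {v : ℝ} (hu : ∀ i, 1 ≤ u i) (hv : 1 ≤ v) :
    Integrable (dirK d u v) := by
  refine ⟨(measurable_dirK u v).aestronglyMeasurable, ?_⟩
  rw [hasFiniteIntegral_iff_ofReal (ae_of_all _ (dirK_nonneg hu hv)), lintegral_dirK hu hv]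
  simp

lemma integral_dirK {d : ℕ} {u : Fin d → ℝ} {v : ℝ} (hu : ∀ i, 1 ≤ u i) (hv : 1 ≤ v) :
    ∫ t, dirK d u v t = 1 := by
  rw [integral_eq_lintegral_of_nonneg_ae (ae_of_all _ (dirK_nonneg hu hv))
    (measurable_dirK u v).aestronglyMeasurable, lintegral_dirK hu hv]
  simp

lemma mul_dirK {d : ℕ} {u : Fin d → ℝ} {v : ℝ} (hu : ∀ i, 1 ≤ u i) (hv : 1 ≤ v)
    (i : Fin d) (t : Fin d → ℝ) :
    t i * dirK d u v t = u i / (v + ∑ j, u j) * dirK d (u + Pi.single i 1) v t := by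
  by_cases ht : t ∈ Sd d
  · rw [dirK, dirK, Set.indicator_of_mem ht, Set.indicator_of_mem ht]
    have hs : 0 ≤ ∑ i, u i := Finset.sum_nonneg fun i _ => by linarith [hu i]
    have h1 : ∏ j, (t j) ^ ((u + Pi.single i 1 : Fin d → ℝ) j - 1) = t i * ∏ j, (t j) ^ (u j - 1) := by
      have : ∀ j, (t j) ^ ((u + Pi.single i 1 : Fin d → ℝ) j - 1) =
          (if j = i then t j else 1) * (t j) ^ (u j - 1) := by
        intro j
        by_cases hj : j = i
        · subst hj
          simp only [Pi.add_apply, Pi.single_eq_same, if_true]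
          rw [show u j + 1 - 1 = (u j - 1) + 1 by ring,
            Real.rpow_add_one' (ht.1 j).1 (by linarith [hu j]), mul_comm]
        · simp [hj]
      simp_rw [this]
      rw [Finset.prod_mul_distrib]
      simp
    have h2 : ∏ j, Real.Gamma ((u + Pi.single i 1 : Fin d → ℝ) j) = u i * ∏ j, Real.Gamma (u j) := by
      have : ∀ j, Real.Gamma ((u + Pi.single i 1 : Fin d → ℝ) j) =
          (if j = i then u j else 1) * Real.Gamma (u j) := by
        intro j
        by_cases hj : j = i
        · subst hj
          simp only [Pi.add_apply, Pi.single_eq_same, if_true]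
          rw [Real.Gamma_add_one (by linarith [hu j])]
        · simp [hj]
      simp_rw [this]
      rw [Finset.prod_mul_distrib]
      simp
    have h3 : v + ∑ j, (u + Pi.single i 1 : Fin d → ℝ) j = (v + ∑ j, u j) + 1 := by
      simp [Finset.sum_add_distrib]; ring
    rw [h1, h2, h3, Real.Gamma_add_one (by linarith)]
    have a1 : v + ∑ j, u j ≠ 0 := by linarith
    have a2 : u i ≠ 0 := by linarith [hu i]
    have a3 : Real.Gamma v ≠ 0 := (Real.Gamma_pos_of_pos (by linarith)).ne'
    have a4 : ∏ j, Real.Gamma (u j) ≠ 0 :=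
      Finset.prod_ne_zero_iff.2 fun j _ => (Real.Gamma_pos_of_pos (by linarith [hu j])).ne'
    field_simp
  · rw [dirK, dirK, Set.indicator_of_notMem ht, Set.indicator_of_notMem ht]
    simp

lemma sq_moment {d : ℕ} {u : Fin d → ℝ} {v : ℝ} (hu : ∀ i, 1 ≤ u i) (hv : 1 ≤ v)
    (i : Fin d) (c : ℝ) :
    Integrable (fun t => (t i - c) ^ 2 * dirK d u v t) ∧
    ∫ t, (t i - c) ^ 2 * dirK d u v t =
      u i / (v + ∑ j, u j) * ((u i + 1) / (v + ∑ j, u j + 1)) - 2 * c * (u i / (v + ∑ j, u j))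
        + c ^ 2 := by
  have hu1 : ∀ j, 1 ≤ (u + Pi.single i 1 : Fin d → ℝ) j := by
    intro j
    have : 0 ≤ (Pi.single i 1 : Fin d → ℝ) j := by
      by_cases hj : j = i
      · subst hj; simp
      · simp [hj]
    simp only [Pi.add_apply]
    linarith [hu j]
  have hu2 : ∀ j, 1 ≤ (u + Pi.single i 1 + Pi.single i 1 : Fin d → ℝ) j := by
    intro j
    have : 0 ≤ (Pi.single i 1 : Fin d → ℝ) j := by
      by_cases hj : j = i
      · subst hj; simp
      · simp [hj]
    have := hu1 j
    rw [Pi.add_apply]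
    linarith
  have h3 : v + ∑ j, (u + Pi.single i 1 : Fin d → ℝ) j = (v + ∑ j, u j) + 1 := by
    simp [Finset.sum_add_distrib]; ring
  have e : (fun t => (t i - c) ^ 2 * dirK d u v t) = fun t =>
      (u i / (v + ∑ j, u j) * ((u i + 1) / (v + ∑ j, u j + 1))) *
        dirK d (u + Pi.single i 1 + Pi.single i 1) v t
      - 2 * c * (u i / (v + ∑ j, u j)) * dirK d (u + Pi.single i 1) v t
      + c ^ 2 * dirK d u v t := by
    ext t
    have m1 := mul_dirK hu hv i t
    have m2 := mul_dirK hu1 hv i t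
    rw [h3] at m2
    simp only [Pi.add_apply, Pi.single_eq_same] at m2
    have : (t i - c) ^ 2 * dirK d u v t = t i * (t i * dirK d u v t)
      - 2 * c * (t i * dirK d u v t) + c ^ 2 * dirK d u v t := by ring
    rw [this, m1, mul_left_comm (t i), m2]
    ring
  have i0 := (integrable_dirK hu hv).const_mul (c ^ 2)
  have i1 := (integrable_dirK hu1 hv).const_mul (2 * c * (u i / (v + ∑ j, u j)))
  have i2 := (integrable_dirK hu2 hv).const_mul
    (u i / (v + ∑ j, u j) * ((u i + 1) / (v + ∑ j, u j + 1)))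
  rw [e]
  refine ⟨(i2.sub i1).add i0, ?_⟩
  refine (integral_add (i2.sub i1) i0).trans ?_
  refine (congrArg₂ (· + ·) (integral_sub i2 i1) rfl).trans ?_
  rw [integral_const_mul, integral_const_mul,
    integral_const_mul, integral_dirK hu hv, integral_dirK hu1 hv, integral_dirK hu2 hv]
  ring

lemma moment_arith {D b x : ℝ} (hD : 0 ≤ D) (hb : 0 < b) (hb1 : b < 1) (hx0 : 0 ≤ x)
    (hx1 : x ≤ 1) (hD1 : 1 ≤ D) :
    (x / b + 1) / (1 / b + 1 + D) * ((x / b + 1 + 1) / (1 / b + 1 + D + 1))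
      - 2 * x * ((x / b + 1) / (1 / b + 1 + D)) + x ^ 2 ≤ (1 + (D + 1) ^ 2) * b := by
  have hib : 0 < 1 / b := by positivity
  set p := (x / b + 1) / (1 / b + 1 + D) with hp
  set U := 1 / b + 1 + D with hU
  have hUp : 0 < U := by positivity
  have hxb : x / b ≤ 1 / b := by gcongr
  have hp0 : 0 ≤ p := by positivity
  have hp1 : p ≤ 1 := by rw [hp, div_le_one hUp]; linarith
  have e1 : x / b + 1 = p * U := by rw [hp]; field_simp
  have e2 : p * ((x / b + 1 + 1) / (U + 1)) - 2 * x * p + x ^ 2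
      = p * (1 - p) / (U + 1) + (x - p) ^ 2 := by
    rw [e1]; field_simp; ring
  rw [e2]
  have e3 : x - p = (x * (1 + D) - 1) / U := by
    rw [hp, hU]; field_simp; ring
  have hUb : 1 / U ≤ b := by
    rw [div_le_comm₀ hUp hb]; linarith
  have v1 : p * (1 - p) / (U + 1) ≤ b := by
    refine le_trans ?_ hUb
    gcongr
    · nlinarith
    · linarith
  have v2 : |x - p| ≤ (D + 1) * b := by
    rw [e3, abs_div, abs_of_pos hUp, div_eq_mul_one_div]
    gcongr
    rw [abs_le]; constructor <;> nlinarith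
  have v3 : (x - p) ^ 2 ≤ ((D + 1) * b) ^ 2 := sq_le_sq' (by linarith [(abs_le.1 v2).1]) (abs_le.1 v2).2
  have : b ^ 2 ≤ b := by nlinarith
  nlinarith [sq_nonneg (D + 1)]

lemma rpow_le_aux {β b x : ℝ} (hβ1 : 1 < β) (hβ2 : β ≤ 2) (hb : 0 < b) (hx : 0 ≤ x) :
    x ^ β ≤ b ^ (β / 2) * (1 + x ^ 2 / b) := by
  have hs : 0 < Real.sqrt b := Real.sqrt_pos.2 hb
  have e : x = Real.sqrt b * (x / Real.sqrt b) := by field_simp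
  have hy : 0 ≤ x / Real.sqrt b := by positivity
  have e2 : x ^ 2 / b = (x / Real.sqrt b) ^ 2 := by rw [div_pow, Real.sq_sqrt hb.le]
  have e3 : Real.sqrt b ^ β = b ^ (β / 2) := by
    rw [Real.sqrt_eq_rpow, ← Real.rpow_mul hb.le]; congr 1; ring
  rw [e2]
  conv_lhs => rw [e]
  rw [Real.mul_rpow hs.le hy, e3]
  gcongr
  set y := x / Real.sqrt b
  rcases le_total y 1 with h | h
  · have := Real.rpow_le_one hy h (by linarith : 0 ≤ β)
    nlinarith [sq_nonneg y]
  · have := Real.rpow_le_rpow_of_exponent_le h hβ2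
    rw [Real.rpow_two] at this
    linarith

/-- Eq. (2.14): for `β ∈ (1,2]` there are `C > 0` (depending only on
`d` and `β`) and `b_0 > 0` such that for all `b ∈ (0,b_0)` and `s ∈ S_d`, the `β`-th
ℓ¹-moment of the `Dirichlet(s/b+1,(1-‖s‖₁)/b+1)` distribution around `s` is at most
`C b^{β/2}`. -/
theorem dirichlet_beta_moment_bound (d : ℕ) (hd : 1 ≤ d) (β : ℝ)
    (hβ1 : 1 < β) (hβ2 : β ≤ 2) :
    ∃ C b0 : ℝ, 0 < C ∧ 0 < b0 ∧ ∀ b ∈ Set.Ioo (0 : ℝ) b0, ∀ s ∈ Sd d,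
      (∫ t in Sd d, (∑ i, |t i - s i|) ^ β * dirKb d b s t) ≤ C * b ^ (β / 2) := by
  refine ⟨1 + d * (d * (1 + ((d : ℝ) + 1) ^ 2)), 1, by positivity, one_pos, ?_⟩
  rintro b ⟨hb, hb1⟩ s hs
  have hd' : (1 : ℝ) ≤ d := by exact_mod_cast hd
  have hu : ∀ i, 1 ≤ s i / b + 1 := fun i => by
    have := div_nonneg (hs.1 i).1 hb.le
    linarith
  have hv : 1 ≤ (1 - ∑ i, s i) / b + 1 := by
    have := div_nonneg (sub_nonneg.2 hs.2) hb.le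
    linarith
  have hsum : (1 - ∑ i, s i) / b + 1 + ∑ i, (s i / b + 1) = 1 / b + 1 + d := by
    rw [Finset.sum_add_distrib, ← Finset.sum_div]
    simp
    ring
  have hm := fun i => sq_moment hu hv i (s i)
  have hi0 := integrable_dirK hu hv
  have h10 := integral_dirK hu hv
  have hn0 := dirK_nonneg hu hv
  change ∀ t, 0 ≤ dirKb d b s t at hn0
  change Integrable (dirKb d b s) at hi0
  change ∫ t, dirKb d b s t = 1 at h10
  have hIntg : ∀ i, Integrable fun t => (t i - s i) ^ 2 * dirKb d b s t := fun i => (hm i).1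
  have hle : ∀ i, ∫ t, (t i - s i) ^ 2 * dirKb d b s t ≤ (1 + ((d : ℝ) + 1) ^ 2) * b := by
    intro i
    have h := (hm i).2
    rw [hsum] at h
    exact h.trans_le (moment_arith (by linarith) hb hb1 (hs.1 i).1 (hs.1 i).2 hd')
  have hIntgS : Integrable fun t => ∑ i, (t i - s i) ^ 2 * dirKb d b s t :=
    integrable_finsetSum _ fun i _ => hIntg i
  set G : (Fin d → ℝ) → ℝ := fun t => b ^ (β / 2) * (dirKb d b s t +
    d / b * ∑ i, (t i - s i) ^ 2 * dirKb d b s t) with hG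
  have hGi : Integrable G := (hi0.add (hIntgS.const_mul _)).const_mul _
  have hbp : 0 ≤ b ^ (β / 2) := Real.rpow_nonneg hb.le _
  have hG0 : ∀ t, 0 ≤ G t := fun t => mul_nonneg hbp (add_nonneg (hn0 t)
    (mul_nonneg (by positivity) (Finset.sum_nonneg fun i _ => mul_nonneg (sq_nonneg _) (hn0 t))))
  calc (∫ t in Sd d, (∑ i, |t i - s i|) ^ β * dirKb d b s t)
      ≤ ∫ t in Sd d, G t := by
        apply integral_mono_of_nonneg
        · exact ae_of_all _ fun t => mul_nonneg
            (Real.rpow_nonneg (Finset.sum_nonneg fun i _ => abs_nonneg _) _) (hn0 t)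
        · exact hGi.restrict
        · refine ae_of_all _ fun t => ?_
          have h1 := rpow_le_aux hβ1 hβ2 hb
            (Finset.sum_nonneg (s := Finset.univ) fun (i : Fin d) _ => abs_nonneg (t i - s i))
          have h2 : (∑ i, |t i - s i|) ^ 2 ≤ d * ∑ i, (t i - s i) ^ 2 := by
            have := sq_sum_le_card_mul_sum_sq (s := Finset.univ) (f := fun i => |t i - s i|)
            simpa using this
          have h3 : (∑ i, |t i - s i|) ^ β ≤
              b ^ (β / 2) * (1 + d / b * ∑ i, (t i - s i) ^ 2) := by
            refine h1.trans ?_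
            rw [div_mul_eq_mul_div]
            gcongr
          refine (mul_le_mul_of_nonneg_right h3 (hn0 t)).trans (le_of_eq ?_)
          simp only [hG]
          rw [← Finset.sum_mul]
          ring
    _ ≤ ∫ t, G t := setIntegral_le_integral hGi (ae_of_all _ hG0)
    _ = b ^ (β / 2) * (1 + d / b * ∑ i, ∫ t, (t i - s i) ^ 2 * dirKb d b s t) := by
        simp only [hG]
        rw [integral_const_mul, integral_add hi0 (hIntgS.const_mul _), integral_const_mul,
          integral_finsetSum _ fun i _ => hIntg i, h10]
    _ ≤ b ^ (β / 2) * (1 + d / b * ∑ _i : Fin d, (1 + ((d : ℝ) + 1) ^ 2) * b) := by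
        gcongr with i
        exact hle i
    _ = _ := by
        simp
        field_simp
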